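/- Let n ≥ 2 and k > 2. There is no Steiner k-system on ℚ^n preserved by AGL_n(ℚ). -/

import Mathlib

/-- `σ` is an element of `AGL_n(ℚ)`: a permutation of `ℚ^n` of the form
`x ↦ T x + b` with `T` an invertible `ℚ`-linear map and `b ∈ ℚ^n`. -/
def IsAGL (n : ℕ) (σ : Equiv.Perm (Fin n → ℚ)) : Prop :=
  ∃ T : (Fin n → ℚ) ≃ₗ[ℚ] (Fin n → ℚ), ∃ b : Fin n → ℚ, ∀ x, σ x = T x + b

/-- `(X, B)` is a Steiner `k`-system: all blocks have the same cardinality,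
every block has more than `k` elements, there is more than one block, and any
`k` pairwise distinct points lie in a unique block. -/
def IsSteinerSystem {X : Type*} (k : ℕ) (B : Set (Set X)) : Prop :=
  (∀ b₁ ∈ B, ∀ b₂ ∈ B, Cardinal.mk b₁ = Cardinal.mk b₂) ∧
  (∀ b ∈ B, (k : Cardinal) < Cardinal.mk b) ∧
  (∃ b₁ ∈ B, ∃ b₂ ∈ B, b₁ ≠ b₂) ∧
  (∀ f : Fin k → X, Function.Injective f → ∃! b, b ∈ B ∧ ∀ i, f i ∈ b)

section Steiner

open Module Submodule

theorem exists_dual_apply_eq_zero_and_forall_ne_zero {V ι : Type*} [AddCommGroup V] [Module ℚ V]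
    [Finite ι] (w : V) (v : ι → V) (hv : ∀ i, v i ∉ span ℚ {w}) :
    ∃ φ : Dual ℚ V, φ w = 0 ∧ ∀ i, φ (v i) ≠ 0 := by
  obtain ⟨φ, hφ, h⟩ := Dual.exists_forall_mem_ne_zero_of_forall_exists
    (span ℚ {w}).dualAnnihilator (fun i ↦ Dual.eval ℚ V (v i)) fun i ↦ by
      obtain ⟨f, hf, hle⟩ := exists_le_ker_of_notMem (hv i)
      exact ⟨f, (mem_dualAnnihilator f).2 fun x hx ↦ hle hx, hf⟩
  exact ⟨φ, (mem_dualAnnihilator φ).1 hφ w (mem_span_singleton_self w), h⟩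

variable {n k : ℕ} {B : Set (Set (Fin n → ℚ))}

theorem IsSteinerSystem.eq_of_mem {X : Type*} {B : Set (Set X)} (hS : IsSteinerSystem k B)
    {b b' : Set X} (hb : b ∈ B) (hb' : b' ∈ B) {f : Fin k → X} (hf : Function.Injective f)
    (h : ∀ i, f i ∈ b) (h' : ∀ i, f i ∈ b') : b = b' :=
  (hS.2.2.2 f hf).unique ⟨hb, h⟩ ⟨hb', h'⟩

theorem IsSteinerSystem.exists_injective {X : Type*} {B : Set (Set X)}
    (hS : IsSteinerSystem k B) {b : Set X} (hb : b ∈ B) :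
    ∃ f : Fin k → X, Function.Injective f ∧ ∀ i, f i ∈ b := by
  obtain ⟨f⟩ : Nonempty (Fin k ↪ b) :=
    Cardinal.lift_mk_le'.1 (by simpa using (hS.2.1 b hb).le)
  exact ⟨fun i ↦ f i, Subtype.val_injective.comp f.injective, fun i ↦ (f i).2⟩

/-- An affine map that sends `k` points of a block into that block preserves the block. -/
theorem IsSteinerSystem.affine_mem (hS : IsSteinerSystem k B)
    (hG : ∀ σ : Equiv.Perm (Fin n → ℚ), IsAGL n σ → ∀ b ∈ B, σ '' b ∈ B)
    {b : Set (Fin n → ℚ)} (hb : b ∈ B) (T : (Fin n → ℚ) ≃ₗ[ℚ] (Fin n → ℚ)) (c : Fin n → ℚ)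
    {f : Fin k → Fin n → ℚ} (hf : Function.Injective f) (h : ∀ i, f i ∈ b)
    (h' : ∀ i, T (f i) + c ∈ b) {x : Fin n → ℚ} (hx : x ∈ b) : T x + c ∈ b := by
  let σ : Equiv.Perm (Fin n → ℚ) := T.toEquiv.trans (Equiv.addRight c)
  have hσ (x) : σ x = T x + c := rfl
  have h_eq : b = σ '' b := hS.eq_of_mem hb (hG σ ⟨T, c, hσ⟩ b hb)
    (f := fun i ↦ σ (f i)) (σ.injective.comp hf) h' fun i ↦ ⟨f i, h i, rfl⟩
  rw [h_eq]
  exact ⟨x, hx, rfl⟩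

/-- The version of `IsSteinerSystem.affine_mem` for dilatransvections. -/
theorem IsSteinerSystem.dilatransvection_mem (hS : IsSteinerSystem k B)
    (hG : ∀ σ : Equiv.Perm (Fin n → ℚ), IsAGL n σ → ∀ b ∈ B, σ '' b ∈ B)
    {b : Set (Fin n → ℚ)} (hb : b ∈ B) (φ : Dual ℚ (Fin n → ℚ)) (o u : Fin n → ℚ)
    (hu : 1 + φ u ≠ 0) {f : Fin k → Fin n → ℚ} (hf : Function.Injective f) (h : ∀ i, f i ∈ b)
    (himg : ∀ i, f i + φ (f i - o) • u ∈ b) {x : Fin n → ℚ} (hx : x ∈ b) :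
    x + φ (x - o) • u ∈ b := by
  have key (y : Fin n → ℚ) : y + φ (y - o) • u =
      LinearEquiv.dilatransvection hu.isUnit y + -(φ o • u) := by
    rw [LinearEquiv.dilatransvection.apply, map_sub, sub_smul]; abel
  rw [key]
  exact hS.affine_mem hG hb _ _ hf h (fun i ↦ key (f i) ▸ himg i) hx

/-- A block that contains `k` points of a line is contained in this line. -/
theorem IsSteinerSystem.sub_mem_span (hS : IsSteinerSystem k B)
    (hG : ∀ σ : Equiv.Perm (Fin n → ℚ), IsAGL n σ → ∀ b ∈ B, σ '' b ∈ B)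
    {b : Set (Fin n → ℚ)} (hb : b ∈ B) (o w : Fin n → ℚ) {f : Fin k → Fin n → ℚ}
    (hf : Function.Injective f) (h : ∀ i, f i ∈ b) (hw : ∀ i, f i - o ∈ span ℚ {w})
    {z : Fin n → ℚ} (hz : z ∈ b) : z - o ∈ span ℚ {w} := by
  by_contra hzo
  have off_line (y : Fin n → ℚ) (hy : y - o ∉ span ℚ {w}) : y ∈ b := by
    obtain ⟨φ, hφw, hφ⟩ := exists_dual_apply_eq_zero_and_forall_ne_zero w ![z - o, y - o]
      (by simp [Fin.forall_fin_two, hzo, hy])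
    have hφz : φ (z - o) ≠ 0 := hφ 0
    have hφy : φ (y - o) ≠ 0 := hφ 1
    have hu : 1 + φ ((φ (z - o))⁻¹ • (y - z)) ≠ 0 := by
      have : 1 + φ ((φ (z - o))⁻¹ • (y - z)) = (φ (z - o))⁻¹ * φ (y - o) := by
        rw [map_smul, smul_eq_mul, show y - z = (y - o) - (z - o) by abel, map_sub φ (y - o)]
        field_simp
        ring
      rw [this]
      positivity
    have hfix (i) : φ (f i - o) = 0 := by
      obtain ⟨c, hc⟩ := mem_span_singleton.1 (hw i)
      rw [← hc, map_smul, hφw, smul_zero]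
    have := hS.dilatransvection_mem hG hb φ o _ hu hf h (fun i ↦ by simpa [hfix] using h i) hz
    rw [smul_smul, mul_inv_cancel₀ hφz, one_smul] at this
    simpa using this
  set v := z - o with hv
  have hv0 : v ≠ 0 := fun h0 ↦ hzo (h0 ▸ zero_mem _)
  have smul_notMem (c : ℚ) (hc : c ≠ 0) : c • v ∉ span ℚ {w} := by
    rwa [smul_mem_iff _ hc]
  have translate (y : Fin n → ℚ) (hy : y ∈ b) : y - v ∈ b := by
    have := hS.affine_mem hG hb (LinearEquiv.refl ℚ _) (-v)
      (f := fun i : Fin k ↦ o + ((i : ℚ) + 2) • v)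
      (fun i j hij ↦ by
        have := smul_left_injective ℚ hv0 (add_left_cancel hij)
        have := add_right_cancel this
        exact Fin.ext (by exact_mod_cast this))
      (fun i ↦ off_line _ (by
        rw [add_sub_cancel_left]
        exact smul_notMem _ (by positivity)))
      (fun i ↦ off_line _ (by
        have : (o + ((i : ℚ) + 2) • v) + -v - o = ((i : ℚ) + 1) • v := by module
        rw [LinearEquiv.refl_apply, this]
        exact smul_notMem _ (by positivity))) hy
    simpa [sub_eq_add_neg] using this
  have mem_all (y : Fin n → ℚ) : y ∈ b := by
    by_cases hy : y - o ∈ span ℚ {w}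
    · rw [show y = y + v - v by abel]
      refine translate _ (off_line _ fun hyv ↦ hzo ?_)
      rw [show v = (y + v - o) - (y - o) by abel]
      exact sub_mem hyv hy
    · exact off_line y hy
  have eq_b (b' : Set (Fin n → ℚ)) (hb' : b' ∈ B) : b' = b := by
    obtain ⟨g, hg, hgb⟩ := hS.exists_injective hb'
    exact hS.eq_of_mem hb' hb hg hgb fun i ↦ mem_all _
  obtain ⟨b₁, hb₁, b₂, hb₂, hne⟩ := hS.2.2.1
  exact hne ((eq_b b₁ hb₁).trans (eq_b b₂ hb₂).symm)

/-- The points `0, e, …, (k - 2) e` together with `p`. -/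
def multiplesWith (k : ℕ) (e p : Fin n → ℚ) (i : Fin k) : Fin n → ℚ :=
  if (i : ℕ) + 1 < k then (i : ℚ) • e else p

theorem multiplesWith_injective {e p : Fin n → ℚ} (he : e ≠ 0)
    (hp : ∀ i : ℕ, i + 1 < k → p ≠ (i : ℚ) • e) : Function.Injective (multiplesWith k e p) := by
  intro i j hij
  unfold multiplesWith at hij
  split_ifs at hij with hi hj hj
  · exact Fin.ext (by exact_mod_cast smul_left_injective ℚ he hij)
  · exact (hp i hi hij.symm).elim
  · exact (hp j hj hij).elim
  · omega

theorem multiplesWith_mem {e p : Fin n → ℚ} {b : Set (Fin n → ℚ)}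
    (he : ∀ i : ℕ, i + 1 < k → (i : ℚ) • e ∈ b) (hp : p ∈ b) (i : Fin k) :
    multiplesWith k e p i ∈ b := by
  unfold multiplesWith
  split_ifs with hi
  · exact he i hi
  · exact hp

theorem ne_smul_of_notMem_span {e p : Fin n → ℚ} (hp : p ∉ span ℚ {e}) (c : ℚ) : p ≠ c • e :=
  fun h ↦ hp (h ▸ smul_mem _ _ (mem_span_singleton_self e))

/-- If a block contains `0, e, …, (k - 2) e` and two further points `p ≠ q`, then a linear form
vanishing at `e` but not at `p` and `q` takes opposite values at `p` and `q`. -/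
theorem IsSteinerSystem.apply_eq_neg (hS : IsSteinerSystem k B)
    (hG : ∀ σ : Equiv.Perm (Fin n → ℚ), IsAGL n σ → ∀ b ∈ B, σ '' b ∈ B) (hk : 2 < k)
    {b : Set (Fin n → ℚ)} (hb : b ∈ B) {e p q : Fin n → ℚ} (he0 : e ≠ 0)
    (he : ∀ i : ℕ, i + 1 < k → (i : ℚ) • e ∈ b) (hp : p ∈ b) (hq : q ∈ b) (hpq : p ≠ q)
    (φ : Dual ℚ (Fin n → ℚ)) (hφe : φ e = 0) (hφp : φ p ≠ 0) (hφq : φ q ≠ 0) :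
    φ q = - φ p := by
  by_contra hneg
  wlog hφp1 : φ p = 1 generalizing φ
  · refine this ((φ p)⁻¹ • φ) (by simp [hφe]) (by simp [hφp]) (by simp [hφp, hφq]) ?_
      (by simp [hφp])
    intro h
    apply hneg
    simp only [LinearMap.smul_apply, smul_eq_mul] at h
    field_simp at h
    linarith
  rw [hφp1] at hneg
  have hu : φ (q - p) = φ q - 1 := by rw [map_sub, hφp1]
  have hpe : ∀ i : ℕ, i + 1 < k → p ≠ (i : ℚ) • e := fun i _ h ↦ hφp (by simp [h, hφe])
  have stable {x : Fin n → ℚ} (hx : x ∈ b) : x + φ x • (q - p) ∈ b := by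
    have := hS.dilatransvection_mem hG hb φ 0 (q - p) (by rw [hu]; simpa using hφq)
      (multiplesWith_injective he0 hpe) (multiplesWith_mem he hp)
      (fun i ↦ by
        unfold multiplesWith
        split_ifs with hi
        · simpa [hφe] using he i hi
        · simpa [hφp1] using hq) hx
    simpa using this
  let c (j : ℕ) : ℚ := ∑ i ∈ Finset.range j, φ q ^ i
  have hcb (j : ℕ) : p + c j • (q - p) ∈ b := by
    induction j with
    | zero => simpa [c] using hp
    | succ j ih =>
      convert stable ih using 1
      have : c (j + 1) = c j * φ q + 1 := by simp only [c]; rw [geom_sum_succ]; ring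
      rw [map_add, map_smul, hu, hφp1, this, smul_eq_mul]
      module
  have c_ne {i j : ℕ} (hij : i < j) : c i ≠ c j := by
    obtain ⟨m, rfl⟩ := Nat.exists_eq_add_of_lt hij
    have hm := geom_sum_ne_zero hneg m.succ_ne_zero
    have : c (i + m + 1) = c i + φ q ^ i * ∑ l ∈ Finset.range (m + 1), φ q ^ l := by
      simp only [c]
      rw [add_assoc, Finset.sum_range_add, Finset.mul_sum]
      simp only [pow_add]
    rw [this]
    simpa using ⟨fun h ↦ absurd h hφq, hm⟩
  have c_inj : Function.Injective c := fun i j hij ↦ by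
    rcases lt_trichotomy i j with h | h | h
    · exact (c_ne h hij).elim
    · exact h
    · exact (c_ne h hij.symm).elim
  have line {x : Fin n → ℚ} (hx : x ∈ b) : ∃ t : ℚ, t • (q - p) = x - p :=
    mem_span_singleton.1 <| hS.sub_mem_span hG hb p (q - p)
      (f := fun i : Fin k ↦ p + c i • (q - p))
      (fun i j hij ↦ Fin.ext (c_inj (smul_left_injective ℚ (sub_ne_zero.2 hpq.symm)
        (add_left_cancel hij))))
      (fun i ↦ hcb i)
      (fun i ↦ by simpa using smul_mem _ _ (mem_span_singleton_self _)) hx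
  obtain ⟨s, hs⟩ := line (he 0 (by omega))
  obtain ⟨t, ht⟩ := line (he 1 (by omega))
  have hs' := congrArg φ hs
  have ht' := congrArg φ ht
  simp only [map_smul, map_sub, hu, hφp1, hφe, smul_eq_mul] at hs' ht'
  have hd : φ q - 1 ≠ 0 := by rintro h; simp [h] at hs'
  have hst : s = t := mul_right_cancel₀ hd (by linarith)
  subst hst
  apply he0
  have := hs.symm.trans ht
  simpa using this.symm

/-- Every block of the system has exactly `k + 1` points. -/
theorem IsSteinerSystem.ncard_eq (hS : IsSteinerSystem k B)
    (hG : ∀ σ : Equiv.Perm (Fin n → ℚ), IsAGL n σ → ∀ b ∈ B, σ '' b ∈ B) (hn : 2 ≤ n)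
    (hk : 2 < k) {b : Set (Fin n → ℚ)} (hb : b ∈ B) : b.ncard = k + 1 := by
  let e : Fin n → ℚ := Pi.single ⟨0, by omega⟩ 1
  let p : Fin n → ℚ := Pi.single ⟨1, by omega⟩ 1
  have he0 : e ≠ 0 := by simp [e]
  have hp : p ∉ span ℚ {e} := by
    intro h
    obtain ⟨c, hc⟩ := mem_span_singleton.1 h
    have := congrFun hc ⟨1, by omega⟩
    simp [e, p] at this
  have hinj : Function.Injective (multiplesWith k e p) :=
    multiplesWith_injective he0 fun i _ ↦ ne_smul_of_notMem_span hp i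
  obtain ⟨b₀, ⟨hb₀, hfb⟩, -⟩ := hS.2.2.2 _ hinj
  have hpb : p ∈ b₀ := by
    simpa [multiplesWith, show k - 1 + 1 = k by omega] using hfb ⟨k - 1, by omega⟩
  have heb (i : ℕ) (hi : i + 1 < k) : (i : ℚ) • e ∈ b₀ := by
    simpa [multiplesWith, hi] using hfb ⟨i, by omega⟩
  have notMem_span {q : Fin n → ℚ} (hq : q ∈ b₀ \ Set.range (multiplesWith k e p)) :
      q ∉ span ℚ {e} := by
    intro hqe
    have := hS.sub_mem_span hG hb₀ 0 e (multiplesWith_injective he0 (p := q) fun i hi h ↦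
        hq.2 ⟨⟨i, by omega⟩, by simp [multiplesWith, hi, h]⟩)
      (multiplesWith_mem heb hq.1)
      (fun i ↦ by
        simpa using multiplesWith_mem (b := (span ℚ {e} : Set (Fin n → ℚ)))
          (fun i _ ↦ smul_mem _ _ (mem_span_singleton_self e)) hqe i) hpb
    exact hp (by simpa using this)
  have ne_p {q : Fin n → ℚ} (hq : q ∈ b₀ \ Set.range (multiplesWith k e p)) : p ≠ q := by
    rintro rfl
    exact hq.2 ⟨⟨k - 1, by omega⟩, by simp [multiplesWith, show k - 1 + 1 = k by omega]⟩
  have subsingleton : (b₀ \ Set.range (multiplesWith k e p)).Subsingleton := by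
    intro q hq r hr
    by_contra hqr
    obtain ⟨φ, hφe, hφ⟩ := exists_dual_apply_eq_zero_and_forall_ne_zero e ![p, q, r]
      (by simp [Fin.forall_fin_succ, hp, notMem_span hq, notMem_span hr])
    have hφp : φ p ≠ 0 := hφ 0
    have hφq : φ q ≠ 0 := hφ 1
    have hφr : φ r ≠ 0 := hφ 2
    have h₁ := hS.apply_eq_neg hG hk hb₀ he0 heb hpb hq.1 (ne_p hq) φ hφe hφp hφq
    have h₂ := hS.apply_eq_neg hG hk hb₀ he0 heb hpb hr.1 (ne_p hr) φ hφe hφp hφr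
    have h₃ := hS.apply_eq_neg hG hk hb₀ he0 heb hq.1 hr.1 hqr φ hφe hφq hφr
    exact hφp (by linarith)
  have hrange : (Set.range (multiplesWith k e p)).ncard = k := by
    rw [Set.ncard_range_of_injective hinj, Nat.card_fin]
  have hsub : Set.range (multiplesWith k e p) ⊆ b₀ := by
    rintro _ ⟨i, rfl⟩
    exact hfb i
  have hfin : b₀.Finite := by
    rw [← Set.sdiff_union_of_subset hsub]
    exact subsingleton.finite.union (Set.finite_range _)
  have hcard := Set.ncard_sdiff_add_ncard_of_subset hsub hfin
  have hle : (b₀ \ Set.range (multiplesWith k e p)).ncard ≤ 1 :=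
    (Set.ncard_le_one subsingleton.finite).2 fun _ hx _ hy ↦ subsingleton hx hy
  have hlt : k < b₀.ncard := by
    have := hS.2.1 b₀ hb₀
    rwa [← Set.cast_ncard hfin, Nat.cast_lt] at this
  have : b.ncard = b₀.ncard := congrArg Cardinal.toNat (hS.1 b hb b₀ hb₀)
  omega

/-- The block through `k` integer multiples of `e` that are permuted by the reflection
`x ↦ c • e - x` contains, apart from these points, only the fixed point of the reflection. -/
theorem IsSteinerSystem.eq_insert_of_reflection (hS : IsSteinerSystem k B)
    (hG : ∀ σ : Equiv.Perm (Fin n → ℚ), IsAGL n σ → ∀ b ∈ B, σ '' b ∈ B) (hn : 2 ≤ n)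
    (hk : 2 < k) {b : Set (Fin n → ℚ)} (hb : b ∈ B) {e : Fin n → ℚ} (he : e ≠ 0)
    {a : Fin k → ℤ} (ha : Function.Injective a) (c : ℤ) (hc : ∀ i, ∃ j, a j = c - a i)
    (hab : ∀ i, (a i : ℚ) • e ∈ b) :
    (∀ i, 2 * a i ≠ c) ∧ b = insert (((c : ℚ) / 2) • e) (Set.range fun i ↦ (a i : ℚ) • e) := by
  have hinj : Function.Injective fun i ↦ (a i : ℚ) • e := fun i j hij ↦
    ha (by exact_mod_cast smul_left_injective ℚ he hij)
  have reflect (i) : ∃ j, (a j : ℚ) • e = - ((a i : ℚ) • e) + (c : ℚ) • e := by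
    obtain ⟨j, hj⟩ := hc i
    refine ⟨j, ?_⟩
    rw [hj]
    push_cast
    module
  have hsub : (Set.range fun i ↦ (a i : ℚ) • e) ⊆ b := by
    rintro _ ⟨i, rfl⟩
    exact hab i
  have hbcard := hS.ncard_eq hG hn hk hb
  have hfin : b.Finite := Set.finite_of_ncard_ne_zero (by omega)
  have hcard := Set.ncard_sdiff_add_ncard_of_subset hsub hfin
  rw [Set.ncard_range_of_injective hinj, Nat.card_fin, hbcard] at hcard
  obtain ⟨r, hr⟩ := Set.ncard_eq_one.1 (show (b \ Set.range fun i ↦ (a i : ℚ) • e).ncard = 1 by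
    omega)
  have hrb : r ∈ b \ Set.range fun i ↦ (a i : ℚ) • e := by rw [hr]; rfl
  have hr_fixed : -r + (c : ℚ) • e = r := by
    have hmem : -r + (c : ℚ) • e ∈ b \ Set.range fun i ↦ (a i : ℚ) • e := by
      refine ⟨hS.affine_mem hG hb (LinearEquiv.neg ℚ) ((c : ℚ) • e) hinj hab (fun i ↦ ?_) hrb.1, ?_⟩
      · obtain ⟨j, hj⟩ := reflect i
        simpa [← hj] using hab j
      · rintro ⟨i, hi⟩
        obtain ⟨j, hj⟩ := reflect i
        refine hrb.2 ⟨j, hj.trans ?_⟩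
        simp only at hi
        rw [hi]
        abel
    rw [hr] at hmem
    exact hmem
  have hr_eq : r = ((c : ℚ) / 2) • e := by
    have : (2 : ℚ) • r = (c : ℚ) • e := by
      nth_rewrite 1 [two_smul, ← hr_fixed]
      abel
    rw [div_eq_inv_mul, mul_smul, ← this, smul_smul]
    norm_num
  rw [← hr_eq]
  refine ⟨fun i hi ↦ hrb.2 ⟨i, ?_⟩, ?_⟩
  · simp only
    rw [hr_eq, ← hi]
    push_cast
    congr 1
    ring
  · rw [← Set.singleton_union, ← hr, Set.sdiff_union_of_subset hsub]

end Steiner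

/-- For `n ≥ 2` and `k > 2`, there is no Steiner `k`-system on `ℚ^n` preserved
by `AGL_n(ℚ)`. -/
theorem no_agl_invariant_steiner_system (n k : ℕ) (hn : 2 ≤ n) (hk : 2 < k) :
    ¬ ∃ B : Set (Set (Fin n → ℚ)), IsSteinerSystem k B ∧
      ∀ σ : Equiv.Perm (Fin n → ℚ), IsAGL n σ → ∀ b ∈ B, σ '' b ∈ B := by
  rintro ⟨B, hS, hG⟩
  obtain ⟨e, he⟩ : ∃ e : Fin n → ℚ, e ≠ 0 := ⟨Pi.single ⟨0, by omega⟩ 1, by simp⟩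
  have exists_block (a : Fin k → ℤ) (ha : Function.Injective a) :
      ∃ b ∈ B, ∀ i, (a i : ℚ) • e ∈ b :=
    (hS.2.2.2 (fun i ↦ (a i : ℚ) • e) fun i j hij ↦
      ha (by exact_mod_cast smul_left_injective ℚ he hij)).exists
  have hinj : Function.Injective fun i : Fin k ↦ (i : ℤ) := fun i j hij ↦ by
    simpa [Fin.ext_iff] using hij
  have hsymm (i : Fin k) : ∃ j : Fin k, (j : ℤ) = (k - 1 : ℤ) - i :=
    ⟨i.rev, by rw [Fin.val_rev]; omega⟩
  obtain ⟨m, rfl | rfl⟩ := k.even_or_odd'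
  · let a (i : Fin (2 * m)) : ℤ := if (i : ℕ) < m then i else i + 1
    have ha : Function.Injective a := fun i j hij ↦ by
      simp only [a] at hij
      split_ifs at hij <;> omega
    obtain ⟨b, hb, hab⟩ := exists_block a ha
    have hb_eq := (hS.eq_insert_of_reflection hG hn hk hb he ha (2 * m) (fun i ↦ ⟨i.rev, by
      simp only [a, Fin.val_rev]
      split_ifs <;> omega⟩) hab).2
    have hmid : ((m : ℤ) : ℚ) • e ∈ b := by
      rw [hb_eq]
      left
      push_cast
      congr 1
      ring
    have hint (x) (hx : x ∈ b) : ∃ t : ℤ, (t : ℚ) • e = x := by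
      rw [hb_eq] at hx
      rcases hx with rfl | ⟨i, rfl⟩
      · exact ⟨m, by push_cast; congr 1; ring⟩
      · exact ⟨a i, rfl⟩
    have hib (i : Fin (2 * m)) : (((i : ℕ) : ℤ) : ℚ) • e ∈ b := by
      rcases lt_trichotomy (i : ℕ) m with hi | hi | hi
      · simpa [a, hi] using hab i
      · rwa [hi]
      · have := hab ⟨i - 1, by omega⟩
        have ha_eq : a ⟨i - 1, by omega⟩ = i := by
          simp only [a]
          split_ifs <;> omega
        rwa [ha_eq] at this
    have hb_eq' := (hS.eq_insert_of_reflection hG hn hk hb he hinj _ hsymm hib).2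
    obtain ⟨t, ht⟩ := hint _ (hb_eq' ▸ Set.mem_insert _ _)
    have ht' : (t : ℚ) = (((2 * m : ℕ) - 1 : ℤ) : ℚ) / 2 := smul_left_injective ℚ he ht
    have : t * 2 = (2 * m : ℕ) - 1 := by
      rw [eq_div_iff two_ne_zero] at ht'
      exact_mod_cast ht'
    omega
  · obtain ⟨b, hb, hab⟩ := exists_block _ hinj
    have h := (hS.eq_insert_of_reflection hG hn hk hb he hinj _ hsymm hab).1 ⟨m, by omega⟩
    apply h
    push_cast
    ring
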